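/- For every infinite binary sequence X, the constructive dimension of X equals the liminf as n tends to infinity of K(X restricted to n)/n, where K denotes prefix-free Kolmogorov complexity. -/

import Mathlib

open Filter Topology

abbrev Cantor := ℕ → Bool

/-- The length-`n` prefix of an infinite binary sequence, as a list. -/
def pref (X : ℕ → Bool) (n : ℕ) : List Bool := (List.range n).map X

/-- An `s`-gale: a nonnegative function on strings satisfying the averaging
condition `2^s d(w) = d(w0) + d(w1)`. -/
def IsSGale (s : ℝ) (d : List Bool → ℝ) : Prop :=
  (∀ w, 0 ≤ d w) ∧ ∀ w, (2 : ℝ) ^ s * d w = d (w ++ [false]) + d (w ++ [true])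

/-- A real-valued function on strings is lower semicomputable (constructive):
it is the pointwise monotone limit of a computable rational approximation. -/
def LowerSemicomputable (d : List Bool → ℝ) : Prop :=
  ∃ g : List Bool → ℕ → ℚ, Computable₂ g ∧
    (∀ w, Monotone fun i => (g w i : ℝ)) ∧
    ∀ w, Filter.Tendsto (fun i => (g w i : ℝ)) Filter.atTop (nhds (d w))

/-- `d` succeeds on `X`: `limsup_n d(X↾n) = ∞`, i.e. `d` is unbounded on the
prefixes of `X`. -/
def SucceedsOn (d : List Bool → ℝ) (X : Cantor) : Prop :=
  ∀ C : ℝ, ∃ n, C < d (pref X n)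

/-- `d` strongly succeeds on `X`: `liminf_n d(X↾n) = ∞`. -/
def StronglySucceedsOn (d : List Bool → ℝ) (X : Cantor) : Prop :=
  ∀ C : ℝ, ∃ N, ∀ n ≥ N, C < d (pref X n)

/-- The constructive dimension of a class: the infimum of all `s ≥ 0` such that
some constructive (lower semicomputable) `s`-gale succeeds on every member. -/
noncomputable def cdim (A : Set Cantor) : ℝ :=
  sInf {s : ℝ | 0 ≤ s ∧ ∃ d : List Bool → ℝ,
    LowerSemicomputable d ∧ IsSGale s d ∧ ∀ X ∈ A, SucceedsOn d X}

/-- The constructive strong dimension of a class: the infimum of all `s ≥ 0`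
such that some constructive `s`-gale strongly succeeds on every member. -/
noncomputable def cDim (A : Set Cantor) : ℝ :=
  sInf {s : ℝ | 0 ≤ s ∧ ∃ d : List Bool → ℝ,
    LowerSemicomputable d ∧ IsSGale s d ∧ ∀ X ∈ A, StronglySucceedsOn d X}

/-- A prefix-free machine: a partial computable map from programs (finite
binary strings) to strings, whose domain is an antichain under the prefix
relation. -/
def PFMachine (M : List Bool →. List Bool) : Prop :=
  Partrec M ∧ ∀ p q : List Bool, (M p).Dom → (M q).Dom → p <+: q → p = q

/-- A universal prefix-free machine: a prefix-free machine simulating every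
prefix-free machine with only a constant overhead in program length. -/
def UniversalPF (U : List Bool →. List Bool) : Prop :=
  PFMachine U ∧ ∀ M : List Bool →. List Bool, PFMachine M → ∃ c : ℕ,
    ∀ w p : List Bool, w ∈ M p → ∃ q : List Bool, w ∈ U q ∧ q.length ≤ p.length + c

/-- Prefix-free Kolmogorov complexity with respect to the machine `U`: the
length of a shortest program producing `w`. -/
noncomputable def K (U : List Bool →. List Bool) (w : List Bool) : ℕ :=
  sInf {n : ℕ | ∃ p : List Bool, w ∈ U p ∧ p.length = n}

/-- `dimK U X = liminf_n K(X↾n)/n`, the (Kolmogorov characterization of the)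
constructive dimension of the sequence `X`. -/
noncomputable def dimK (U : List Bool →. List Bool) (X : Cantor) : ℝ :=
  Filter.liminf (fun n : ℕ => (K U (pref X n) : ℝ) / n) Filter.atTop

/-- `DimK U X = limsup_n K(X↾n)/n`, the (Kolmogorov characterization of the)
constructive strong dimension of the sequence `X`. -/
noncomputable def DimK (U : List Bool →. List Bool) (X : Cantor) : ℝ :=
  Filter.limsup (fun n : ℕ => (K U (pref X n) : ℝ) / n) Filter.atTop

/-! ### Computability on `ℚ` with Mathlib's encoding -/

/-- The code of a rational number before renumbering. -/
def oldE (q : ℚ) : ℕ := @Encodable.encode ℚ Rat.instEncodable q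

theorem oldE_eq (q : ℚ) : oldE q = Nat.pair (Encodable.encode q.num) q.den := rfl

theorem encZ_ofNat (n : ℕ) : Encodable.encode (Int.ofNat n) = 2 * n := rfl

theorem encZ_negSucc (n : ℕ) : Encodable.encode (Int.negSucc n) = 2 * n + 1 := rfl

theorem encZ_natAbs (z : ℤ) : z.natAbs = (Encodable.encode z + 1) / 2 := by
  cases z with
  | ofNat n => rw [encZ_ofNat]; simp; omega
  | negSucc n => rw [encZ_negSucc]; simp; omega

theorem oldE_injective : Function.Injective oldE := @Encodable.encode_injective ℚ Rat.instEncodable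

/-- The code of a rational number used by `Primcodable ℚ`. -/
def newE (q : ℚ) : ℕ := @Encodable.encode ℚ Primcodable.toEncodable q

theorem newE_eq (q : ℚ) : newE q = (List.range (oldE q)).countP
    (fun x => @decide (x ∈ Set.range oldE) (@Encodable.decidableRangeEncode ℚ _ x)) := by
  rfl

theorem mem_range_oldE (n : ℕ) : n ∈ Set.range oldE ↔
    0 < n.unpair.2 ∧ Nat.gcd ((n.unpair.1 + 1) / 2) n.unpair.2 = 1 := by
  constructor
  · rintro ⟨q, rfl⟩
    rw [oldE_eq]
    simp only [Nat.unpair_pair]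
    rw [← encZ_natAbs]
    exact ⟨q.den_pos, q.reduced⟩
  · rintro ⟨h1, h2⟩
    obtain ⟨z, hz⟩ : ∃ z : ℤ, Encodable.encode z = n.unpair.1 :=
      ⟨Equiv.intEquivNat.symm n.unpair.1, Equiv.intEquivNat.apply_symm_apply _⟩
    rw [← hz, ← encZ_natAbs] at h2
    refine ⟨⟨z, n.unpair.2, h1.ne', h2⟩, ?_⟩
    rw [oldE_eq]
    simp only [hz, Nat.pair_unpair]

theorem primrec_nat_dvd : PrimrecRel (fun a b : ℕ => a ∣ b) := by
  have : PrimrecRel (fun a b : ℕ => b % a = 0) :=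
    Primrec.eq.comp (Primrec.nat_mod.comp Primrec.snd Primrec.fst) (Primrec.const 0)
  exact this.of_eq (fun a b => (Nat.dvd_iff_mod_eq_zero).symm)

theorem primrec_gcd_one : PrimrecRel (fun a b : ℕ => 0 < b ∧ Nat.gcd a b = 1) := by
  have h1 : PrimrecRel (fun (x : ℕ) (p : ℕ) => ¬ (x ∣ p.unpair.1 ∧ x ∣ p.unpair.2) ∨ x ≤ 1) := by
    refine PrimrecPred.or (PrimrecPred.not (PrimrecPred.and ?_ ?_)) ?_
    · exact primrec_nat_dvd.comp Primrec.fst (Primrec.fst.comp (Primrec.unpair.comp Primrec.snd))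
    · exact primrec_nat_dvd.comp Primrec.fst (Primrec.snd.comp (Primrec.unpair.comp Primrec.snd))
    · exact Primrec.nat_le.comp Primrec.fst (Primrec.const 1)
  have h2 := h1.forall_lt
  have h3 : PrimrecRel (fun a b : ℕ => 0 < b ∧
      ∀ x < b + 1, ¬ (x ∣ a ∧ x ∣ b) ∨ x ≤ 1) := by
    refine PrimrecPred.and ?_ ?_
    · exact Primrec.nat_lt.comp (Primrec.const 0) Primrec.snd
    · refine (h2.comp (Primrec.succ.comp Primrec.snd)
        (Primrec₂.natPair.comp Primrec.fst Primrec.snd)).of_eq (fun p => ?_)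
      simp only [Nat.unpair_pair]
  refine h3.of_eq (fun a b => and_congr_right fun hb => ?_)
  constructor
  · intro h
    have hle : Nat.gcd a b < b + 1 := Nat.lt_succ_of_le (Nat.gcd_le_right a hb)
    rcases h _ hle with h | h
    · exact absurd ⟨Nat.gcd_dvd_left a b, Nat.gcd_dvd_right a b⟩ h
    · have := Nat.gcd_pos_of_pos_right a hb
      omega
  · intro h x _
    by_cases hx : x ∣ a ∧ x ∣ b
    · right
      have := Nat.dvd_gcd hx.1 hx.2
      rw [h] at this
      exact Nat.le_of_dvd one_pos this
    · exact Or.inl hx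

theorem primrec_range_oldE : PrimrecPred (fun n => n ∈ Set.range oldE) := by
  have : PrimrecPred (fun n : ℕ => 0 < n.unpair.2 ∧
      Nat.gcd ((n.unpair.1 + 1) / 2) n.unpair.2 = 1) := by
    refine primrec_gcd_one.comp (f := fun n : ℕ => (n.unpair.1 + 1) / 2) ?_
      (Primrec.snd.comp Primrec.unpair)
    exact Primrec.nat_div.comp (Primrec.succ.comp (Primrec.fst.comp Primrec.unpair))
      (Primrec.const 2)
  exact this.of_eq (fun n => (mem_range_oldE n).symm)

/-- Counting function of the set of codes. -/
def cntE (n : ℕ) : ℕ := (List.range n).countP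
    (fun x => @decide (x ∈ Set.range oldE) (@Encodable.decidableRangeEncode ℚ _ x))

theorem primrec_cntE : Primrec cntE := by
  let _ : DecidablePred (fun x => x ∈ Set.range oldE) := @Encodable.decidableRangeEncode ℚ _
  have h := Primrec.list_length.comp ((Primrec.listFilter primrec_range_oldE).comp
    Primrec.list_range)
  refine h.of_eq (fun n => ?_)
  rw [cntE, List.countP_eq_length_filter]

theorem newE_injective : Function.Injective newE :=
  @Encodable.encode_injective ℚ Primcodable.toEncodable

theorem newE_surjective (n : ℕ) : ∃ q, newE q = n :=
  ⟨Denumerable.ofNat ℚ n, Denumerable.encode_ofNat n⟩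

theorem primrec_newE : Primrec newE := Primrec.encode

/-- Decoding of rationals. -/
def ofE (n : ℕ) : ℚ := Denumerable.ofNat ℚ n

theorem computable_ofE : Computable ofE := Computable.ofNat ℚ

theorem ofE_newE (q : ℚ) : ofE (newE q) = q := Denumerable.ofNat_encode q

theorem newE_ofE (n : ℕ) : newE (ofE n) = n := Denumerable.encode_ofNat n

theorem computable_oldE : Computable oldE := by
  classical
  have hP : Primrec₂ (fun (q : ℚ) (n : ℕ) =>
      decide (n ∈ Set.range oldE ∧ cntE n = newE q)) := by
    have : PrimrecRel (fun (q : ℚ) (n : ℕ) =>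
      (n ∈ Set.range oldE ∧ cntE n = newE q)) := by
      refine PrimrecPred.and (primrec_range_oldE.comp Primrec.snd) ?_
      exact Primrec.eq.comp (primrec_cntE.comp Primrec.snd) (primrec_newE.comp Primrec.fst)
    exact this.decide
  have h := Partrec.rfind (hP.to_comp.partrec₂)
  refine h.of_eq_tot (fun q => ?_)
  rw [Nat.mem_rfind]
  have key : ∀ m, m ∈ Set.range oldE → cntE m = newE q → m = oldE q := by
    rintro _ ⟨q', rfl⟩ h
    have : newE q' = newE q := h
    rw [newE_injective this]
  constructor
  · simp [newE_eq, cntE]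
  · intro m hm
    by_contra hc
    apply hm.ne
    apply key
    · by_contra h
      exact hc (by simp_all)
    · by_contra h
      exact hc (by simp_all)

theorem computable_oldNum : Computable (fun q : ℚ => Encodable.encode q.num) := by
  have := (Primrec.fst.comp Primrec.unpair).to_comp.comp computable_oldE
  refine this.of_eq (fun q => ?_)
  rw [oldE_eq]; simp

theorem computable_den : Computable (fun q : ℚ => q.den) := by
  have := (Primrec.snd.comp Primrec.unpair).to_comp.comp computable_oldE
  refine this.of_eq (fun q => ?_)
  rw [oldE_eq]; simp

/-- Cross-multiplication test in terms of codes. -/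
theorem rat_eq_iff (q : ℚ) (n m : ℕ) (hm : 0 < m) :
    q = (n : ℚ) / m ↔
    Encodable.encode q.num % 2 = 0 ∧ Encodable.encode q.num * m = 2 * n * q.den := by
  have hm' : (m : ℚ) ≠ 0 := by positivity
  have hd : (q.den : ℚ) ≠ 0 := by exact_mod_cast q.den_nz
  have h1 : q = (n : ℚ) / m ↔ q.num * m = (n : ℤ) * q.den := by
    conv_lhs => rw [← Rat.num_div_den q]
    rw [div_eq_div_iff hd hm']
    exact_mod_cast Iff.rfl
  rw [h1]
  cases hz : q.num with
  | ofNat k =>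
    rw [encZ_ofNat]
    have : (Int.ofNat k * (m : ℤ) = (n : ℤ) * (q.den : ℤ)) ↔ k * m = n * q.den := by
      simp only [Int.ofNat_eq_natCast]
      exact_mod_cast Iff.rfl
    rw [this, mul_assoc, mul_assoc]
    omega
  | negSucc k =>
    rw [encZ_negSucc]
    constructor
    · intro h
      exfalso
      have h1 : Int.negSucc k * (m : ℤ) < 0 :=
        mul_neg_of_neg_of_pos (Int.negSucc_lt_zero k) (by exact_mod_cast hm)
      have h2 : 0 ≤ (n : ℤ) * q.den := by positivity
      omega
    · intro h
      omega

theorem one_lt_rat_iff (q : ℚ) : 1 < q ↔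
    Encodable.encode q.num % 2 = 0 ∧ 2 * q.den < Encodable.encode q.num := by
  have hd : (0 : ℚ) < q.den := by exact_mod_cast q.den_pos
  have h1 : 1 < q ↔ (q.den : ℤ) < q.num := by
    conv_lhs => rw [← Rat.num_div_den q]
    rw [lt_div_iff₀ hd, one_mul]
    exact_mod_cast Iff.rfl
  rw [h1]
  cases hz : q.num with
  | ofNat k =>
    rw [encZ_ofNat]
    simp only [Int.ofNat_eq_natCast]
    omega
  | negSucc k =>
    rw [encZ_negSucc]
    have := Int.negSucc_lt_zero k
    omega

theorem computable_one_lt : Computable (fun q : ℚ => decide (1 < q)) := by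
  have hp : Primrec₂ (fun (a b : ℕ) => decide (a % 2 = 0 ∧ 2 * b < a)) := by
    have : PrimrecRel (fun a b : ℕ => a % 2 = 0 ∧ 2 * b < a) := by
      refine PrimrecPred.and ?_ ?_
      · exact Primrec.eq.comp (Primrec.nat_mod.comp Primrec.fst (Primrec.const 2)) (Primrec.const 0)
      · exact Primrec.nat_lt.comp (Primrec.nat_mul.comp (Primrec.const 2) Primrec.snd) Primrec.fst
    exact this.decide
  refine (hp.to_comp.comp computable_oldNum computable_den).of_eq (fun q => ?_)
  simp only [one_lt_rat_iff]

theorem computable_ratdiv {α : Type*} [Primcodable α] {f g : α → ℕ} (hf : Computable f)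
    (hg : Computable g) (h0 : ∀ a, 0 < g a) : Computable (fun a => (f a : ℚ) / g a) := by
  have hp : Primrec₂ (fun (a b : ℕ × ℕ) => decide (a.1 % 2 = 0 ∧ a.1 * b.2 = 2 * b.1 * a.2)) := by
    have : PrimrecRel (fun (a b : ℕ × ℕ) => a.1 % 2 = 0 ∧ a.1 * b.2 = 2 * b.1 * a.2) := by
      refine PrimrecPred.and ?_ (Primrec.eq.comp ?_ ?_)
      · exact Primrec.eq.comp (Primrec.nat_mod.comp (Primrec.fst.comp Primrec.fst)
          (Primrec.const 2)) (Primrec.const 0)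
      · exact Primrec.nat_mul.comp (Primrec.fst.comp Primrec.fst) (Primrec.snd.comp Primrec.snd)
      · exact Primrec.nat_mul.comp (Primrec.nat_mul.comp (Primrec.const 2)
          (Primrec.fst.comp Primrec.snd)) (Primrec.snd.comp Primrec.fst)
    exact this.decide
  have hc : Computable₂ (fun (a : α) (q : ℚ) =>
      decide (Encodable.encode q.num % 2 = 0 ∧
        Encodable.encode q.num * g a = 2 * f a * q.den)) :=
    hp.to_comp.comp ((computable_oldNum.comp Computable.snd).pair
      (computable_den.comp Computable.snd))
      ((hf.comp Computable.fst).pair (hg.comp Computable.fst))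
  have hc2 : Computable₂ (fun (a : α) (e : ℕ) => decide
      (Encodable.encode (ofE e).num % 2 = 0 ∧
        Encodable.encode (ofE e).num * g a = 2 * f a * (ofE e).den)) :=
    hc.comp Computable.fst (computable_ofE.comp Computable.snd)
  have h := (Partrec.rfind hc2.partrec₂)
  have hE : Computable (fun a => newE ((f a : ℚ) / g a)) := by
    refine h.of_eq_tot (fun a => ?_)
    rw [Nat.mem_rfind]
    constructor
    · have := (rat_eq_iff ((f a : ℚ) / g a) (f a) (g a) (h0 a)).1 rfl
      rw [← ofE_newE ((f a : ℚ) / g a)] at this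
      exact Part.mem_some_iff.2 (decide_eq_true this).symm
    · intro m hm
      have : ¬ (ofE m = (f a : ℚ) / g a) := by
        intro h
        rw [← h, newE_ofE] at hm
        exact lt_irrefl _ hm
      rw [rat_eq_iff _ _ _ (h0 a)] at this
      have h2 := decide_eq_false this
      exact Part.mem_some_iff.2 h2.symm
  exact (computable_ofE.comp hE).of_eq (fun a => ofE_newE _)

/-! ### Strings of given length, cylinder weights and the Kraft inequality -/

/-- The finite set of binary strings of length `n`. -/
def strs : ℕ → Finset (List Bool)
  | 0 => {[]}
  | n + 1 => (strs n).image (fun w => w ++ [false]) ∪ (strs n).image (fun w => w ++ [true])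

theorem mem_strs {n : ℕ} {w : List Bool} : w ∈ strs n ↔ w.length = n := by
  induction n generalizing w with
  | zero => simp [strs]
  | succ n ih =>
    simp only [strs, Finset.mem_union, Finset.mem_image, ih]
    constructor
    · rintro (⟨v, hv, rfl⟩ | ⟨v, hv, rfl⟩) <;> simp [hv]
    · intro h
      rcases List.eq_nil_or_concat w with rfl | ⟨v, b, rfl⟩
      · simp at h
      · have hv : v.length = n := by simpa using h
        cases b
        · exact Or.inl ⟨v, hv, by simp⟩
        · exact Or.inr ⟨v, hv, by simp⟩

theorem sum_strs_succ {R : Type*} [AddCommMonoid R] (f : List Bool → R) (n : ℕ) :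
    ∑ w ∈ strs (n + 1), f w = ∑ w ∈ strs n, (f (w ++ [false]) + f (w ++ [true])) := by
  rw [strs, Finset.sum_union, Finset.sum_image, Finset.sum_image, Finset.sum_add_distrib]
  · intro a _ b _ h; simpa using h
  · intro a _ b _ h; simpa using h
  · rw [Finset.disjoint_left]
    intro x hx hy
    simp only [Finset.mem_image] at hx hy
    obtain ⟨a, _, rfl⟩ := hx
    obtain ⟨b, _, hb⟩ := hy
    have := (List.append_inj' hb rfl).2
    simp at this

theorem card_strs (n : ℕ) : (strs n).card = 2 ^ n := by
  induction n with
  | zero => simp [strs]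
  | succ n ih =>
    have := sum_strs_succ (fun _ => (1 : ℕ)) n
    rw [Finset.card_eq_sum_ones, this, Finset.sum_const, ih]
    simp [pow_succ]

/-- `2^|w|` times the uniform measure on the cylinder of `v` of the cylinder of `w`. -/
def hW (v w : List Bool) : ℕ :=
  if w <+: v then 2 ^ w.length else if v <+: w then 2 ^ v.length else 0

theorem hW_gale (v w : List Bool) : 2 * hW v w = hW v (w ++ [false]) + hW v (w ++ [true]) := by
  have nle : ∀ b, ¬ (w ++ [b]) <+: w := fun b h => by
    have := h.length_le
    simp at this
  by_cases h1 : w <+: v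
  · obtain ⟨u, rfl⟩ := h1
    cases u with
    | nil => simp [hW, two_mul, nle]
    | cons b u =>
      have nv : ∀ c, b ≠ c → ¬ (w ++ b :: u) <+: w ++ [c] := fun c hc h => by
        rw [List.prefix_append_right_inj] at h
        simp [List.cons_prefix_cons, hc] at h
      cases b <;> simp [hW, List.prefix_append_right_inj, List.cons_prefix_cons, pow_succ, mul_comm]
  · have n1 : ∀ b, ¬ (w ++ [b]) <+: v := fun b h => h1 ((List.prefix_append w [b]).trans h)
    by_cases h2 : v <+: w
    · have h3 : ∀ b, v <+: w ++ [b] := fun b => h2.trans (List.prefix_append w [b])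
      simp [hW, h1, n1, h2, h3, two_mul]
    · have h3 : ∀ b, ¬ v <+: w ++ [b] := by
        intro b h
        rcases List.prefix_concat_iff.1 h with h | h
        · exact h1 (h ▸ List.prefix_append w [b])
        · exact h2 h
      simp [hW, h1, n1, h2, h3]

theorem sum_hW (v : List Bool) (n : ℕ) : ∑ w ∈ strs n, hW v w = 2 ^ n := by
  induction n with
  | zero => simp [strs, hW]
  | succ n ih =>
    rw [sum_strs_succ, Finset.sum_congr rfl (fun w _ => (hW_gale v w).symm), ← Finset.mul_sum, ih,
      pow_succ, mul_comm]

theorem hW_le (v w : List Bool) : hW v w ≤ 2 ^ w.length := by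
  unfold hW
  split_ifs with h1 h2
  · exact le_rfl
  · exact Nat.pow_le_pow_right (by norm_num) h2.length_le
  · exact Nat.zero_le _

theorem hW_self (v : List Bool) : hW v v = 2 ^ v.length := by simp [hW]

theorem kraft (F : Finset (List Bool)) (N : ℕ) (hN : ∀ p ∈ F, p.length ≤ N)
    (hF : ∀ p ∈ F, ∀ q ∈ F, p <+: q → p = q) : ∑ p ∈ F, 2 ^ (N - p.length) ≤ 2 ^ N := by
  classical
  have h1 : ∀ p ∈ F, 2 ^ (N - p.length) = ∑ x ∈ strs N, if p <+: x then 1 else 0 := by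
    intro p hp
    have h2 := sum_hW p N
    have h3 : ∀ x ∈ strs N, hW p x = 2 ^ p.length * (if p <+: x then 1 else 0) := by
      intro x hx
      rw [mem_strs] at hx
      unfold hW
      by_cases hxp : x <+: p
      · have : x = p := hxp.eq_of_length_le (by rw [hx]; exact hN p hp)
        subst this
        simp
      · by_cases hpx : p <+: x <;> simp [hxp, hpx]
    rw [Finset.sum_congr rfl h3, ← Finset.mul_sum] at h2
    have h4 : 2 ^ N = 2 ^ p.length * 2 ^ (N - p.length) := by
      rw [← pow_add, Nat.add_sub_cancel' (hN p hp)]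
    rw [h4] at h2
    exact (Nat.eq_of_mul_eq_mul_left (by positivity) h2).symm
  rw [Finset.sum_congr rfl h1, Finset.sum_comm, ← card_strs N, Finset.card_eq_sum_ones]
  refine Finset.sum_le_sum (fun x _ => ?_)
  rw [← Finset.sum_filter, ← Finset.card_eq_sum_ones, Finset.card_le_one]
  intro a ha b hb
  simp only [Finset.mem_filter] at ha hb
  rcases List.prefix_or_prefix_of_prefix ha.2 hb.2 with h | h
  · exact hF a ha.1 b hb.1 h
  · exact (hF b hb.1 a ha.1 h).symm

/-! ### The gale built from a prefix-free machine -/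

theorem primrec_pow : Primrec₂ (fun a b : ℕ => a ^ b) :=
  Primrec₂.unpaired'.1 Nat.Primrec.pow

theorem exists_stages (U : List Bool →. List Bool) (hU : Partrec U) :
    ∃ V : ℕ → ℕ → Option (List Bool × List Bool), Primrec₂ V ∧
      (∀ i j n x, i ≤ j → x ∈ V i n → x ∈ V j n) ∧
      (∀ i n p v, (p, v) ∈ V i n → Encodable.encode p = n ∧ n < i ∧ v ∈ U p) ∧
      (∀ p v, v ∈ U p → ∃ i, (p, v) ∈ V i (Encodable.encode p)) := by
  obtain ⟨c, hc⟩ := Nat.Partrec.Code.exists_code.1 hU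
  have hev : ∀ (p : List Bool) x, x ∈ Nat.Partrec.Code.eval c (Encodable.encode p) ↔
      ∃ v ∈ U p, Encodable.encode v = x := by
    intro p x
    rw [hc]
    simp
  refine ⟨fun i n => (Encodable.decode₂ (List Bool) n).bind fun p =>
    ((Nat.Partrec.Code.evaln i c n).bind fun m => Encodable.decode (α := List Bool) m).map
      fun v => (p, v), ?_, ?_, ?_, ?_⟩
  · have hE : Primrec₂ (fun i n : ℕ => Nat.Partrec.Code.evaln i c n) :=
      Nat.Partrec.Code.primrec_evaln.comp
        ((Primrec.fst.pair (Primrec.const c)).pair Primrec.snd)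
    have hV : Primrec (fun x : ℕ × ℕ => (Nat.Partrec.Code.evaln x.1 c x.2).bind
        fun m => Encodable.decode (α := List Bool) m) :=
      Primrec.option_bind hE (Primrec.decode.comp Primrec.snd)
    refine Primrec.option_bind (Primrec.decode₂.comp Primrec.snd) ?_
    refine Primrec.option_map (hV.comp Primrec.fst) ?_
    exact (Primrec.snd.comp Primrec.fst).pair Primrec.snd
  · intro i j n x hij hx
    simp only [Option.mem_def, Option.bind_eq_some_iff, Option.map_eq_some_iff] at hx ⊢
    obtain ⟨p, hp, v, ⟨m, hm, hv⟩, rfl⟩ := hx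
    exact ⟨p, hp, v, ⟨m, Nat.Partrec.Code.evaln_mono hij hm, hv⟩, rfl⟩
  · intro i n p v hx
    simp only [Option.mem_def, Option.bind_eq_some_iff, Option.map_eq_some_iff] at hx
    obtain ⟨p', hp, v', ⟨m, hm, hv⟩, h⟩ := hx
    obtain ⟨rfl, rfl⟩ := Prod.mk.inj h
    have hp' : Encodable.encode p' = n := Encodable.mem_decode₂.1 hp
    refine ⟨hp', Nat.Partrec.Code.evaln_bound hm, ?_⟩
    have := Nat.Partrec.Code.evaln_sound hm
    rw [← hp', hev] at this
    obtain ⟨u, hu, rfl⟩ := this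
    rw [Encodable.encodek] at hv
    cases hv
    exact hu
  · intro p v hv
    have := (hev p (Encodable.encode v)).2 ⟨v, hv, rfl⟩
    obtain ⟨i, hi⟩ := Nat.Partrec.Code.evaln_complete.1 this
    refine ⟨i, ?_⟩
    simp only [Option.mem_def, Option.bind_eq_some_iff, Option.map_eq_some_iff]
    exact ⟨p, Encodable.mem_decode₂.2 rfl, v, ⟨_, hi, Encodable.encodek v⟩, rfl⟩

theorem primrec_prefix : PrimrecRel (fun v w : List Bool => v <+: w) := by
  have : PrimrecRel (fun v w : List Bool => v = w.take v.length) :=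
    Primrec.eq.comp Primrec.fst (Primrec.list_take.comp (Primrec.list_length.comp Primrec.fst)
      Primrec.snd)
  exact this.of_eq (fun v w => List.prefix_iff_eq_take.symm)

theorem primrec_hW : Primrec₂ hW := by
  refine Primrec.ite (primrec_prefix.comp Primrec.snd Primrec.fst) ?_
    (Primrec.ite (primrec_prefix.comp Primrec.fst Primrec.snd) ?_ (Primrec.const 0))
  · exact primrec_pow.comp (Primrec.const 2) (Primrec.list_length.comp Primrec.snd)
  · exact primrec_pow.comp (Primrec.const 2) (Primrec.list_length.comp Primrec.fst)

theorem primrec_sum {α : Type*} [Primcodable α] {f : α → ℕ → ℕ} {l : α → ℕ} (hf : Primrec₂ f)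
    (hl : Primrec l) : Primrec (fun a => ∑ n ∈ Finset.range (l a), f a n) := by
  have h : Primrec (fun a => Nat.rec (motive := fun _ => ℕ) 0 (fun n s => s + f a n) (l a)) := by
    refine Primrec.nat_rec' hl (Primrec.const 0) (h := fun a p => p.2 + f a p.1) ?_
    exact Primrec.nat_add.comp (Primrec.snd.comp Primrec.snd)
      (hf.comp Primrec.fst (Primrec.fst.comp Primrec.snd))
  refine h.of_eq (fun a => ?_)
  induction l a with
  | zero => simp
  | succ n ih => rw [Finset.sum_range_succ, ← ih]

/-- Contribution of one program to the gale at stage `i`. -/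
def termV (V : ℕ → ℕ → Option (List Bool × List Bool)) (w : List Bool) (i n : ℕ) : ℕ :=
  ((V i n).map fun x => 2 ^ (i - x.1.length) * hW x.2 w).getD 0

/-- Scaled value of the gale at stage `i`. -/
def numV (V : ℕ → ℕ → Option (List Bool × List Bool)) (w : List Bool) (i : ℕ) : ℕ :=
  ∑ n ∈ Finset.range i, termV V w i n

theorem primrec_numV {V : ℕ → ℕ → Option (List Bool × List Bool)} (hV : Primrec₂ V) :
    Primrec₂ (numV V) := by
  have : Primrec₂ (fun (x : List Bool × ℕ) (n : ℕ) => termV V x.1 x.2 n) := by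
    have h1 : Primrec₂ (fun (y : (List Bool × ℕ) × ℕ) (x : List Bool × List Bool) =>
        2 ^ (y.1.2 - x.1.length) * hW x.2 y.1.1) := by
      refine Primrec.nat_mul.comp (primrec_pow.comp (Primrec.const 2) (Primrec.nat_sub.comp ?_ ?_))
        (primrec_hW.comp ?_ ?_)
      · exact Primrec.snd.comp (Primrec.fst.comp Primrec.fst)
      · exact Primrec.list_length.comp (Primrec.fst.comp Primrec.snd)
      · exact Primrec.snd.comp Primrec.snd
      · exact Primrec.fst.comp (Primrec.fst.comp Primrec.fst)
    refine Primrec.option_getD.comp (Primrec.option_map ?_ h1) (Primrec.const 0)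
    exact hV.comp (Primrec.snd.comp Primrec.fst) Primrec.snd
  exact primrec_sum this Primrec.snd

theorem numV_gale (V : ℕ → ℕ → Option (List Bool × List Bool)) (w : List Bool) (i : ℕ) :
    2 * numV V w i = numV V (w ++ [false]) i + numV V (w ++ [true]) i := by
  unfold numV
  rw [Finset.mul_sum, ← Finset.sum_add_distrib]
  refine Finset.sum_congr rfl (fun n _ => ?_)
  unfold termV
  cases V i n with
  | none => simp
  | some x =>
    simp only [Option.map_some, Option.getD_some]
    rw [← mul_add, ← hW_gale]
    ring

section
variable {U : List Bool →. List Bool} {V : ℕ → ℕ → Option (List Bool × List Bool)}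

theorem numV_mono (hmono : ∀ i j n x, i ≤ j → x ∈ V i n → x ∈ V j n)
    (hsound : ∀ i n p v, (p, v) ∈ V i n → Encodable.encode p = n ∧ n < i ∧ v ∈ U p)
    (w : List Bool) (i : ℕ) : 2 * numV V w i ≤ numV V w (i + 1) := by
  unfold numV
  rw [Finset.mul_sum, Finset.sum_range_succ]
  refine le_add_right (Finset.sum_le_sum (fun n _ => ?_))
  unfold termV
  cases hx : V i n with
  | none => simp
  | some x =>
    have h1 := hmono i (i + 1) n x (Nat.le_succ i) hx
    obtain ⟨p, v⟩ := x
    obtain ⟨h2, h3, h4⟩ := hsound i n p v hx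
    rw [Option.mem_def.1 h1]
    simp only [Option.map_some, Option.getD_some]
    have h5 : p.length ≤ i := (Encodable.length_le_encode p).trans (by omega)
    rw [Nat.succ_sub h5, pow_succ]
    apply le_of_eq
    ring

theorem numV_le (hU : PFMachine U)
    (hsound : ∀ i n p v, (p, v) ∈ V i n → Encodable.encode p = n ∧ n < i ∧ v ∈ U p)
    (w : List Bool) (i : ℕ) : numV V w i ≤ 2 ^ i * 2 ^ w.length := by
  classical
  -- the finite set of programs seen at stage `i`
  let F : Finset (List Bool) :=
    ((Finset.range i).filter (fun n => (V i n).isSome)).image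
      (fun n => ((V i n).map Prod.fst).getD [])
  have hFmem : ∀ p ∈ F, ∃ n v, (p, v) ∈ V i n := by
    intro p hp
    simp only [F, Finset.mem_image, Finset.mem_filter] at hp
    obtain ⟨n, ⟨_, hn⟩, rfl⟩ := hp
    obtain ⟨⟨p, v⟩, hx⟩ := Option.isSome_iff_exists.1 hn
    exact ⟨n, v, by simp [hx]⟩
  have hk : ∑ p ∈ F, 2 ^ (i - p.length) ≤ 2 ^ i := by
    apply kraft
    · intro p hp
      obtain ⟨n, v, h⟩ := hFmem p hp
      obtain ⟨h2, h3, _⟩ := hsound i n p v h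
      exact (Encodable.length_le_encode p).trans (by omega)
    · intro p hp q hq hpq
      obtain ⟨n, v, h⟩ := hFmem p hp
      obtain ⟨m, u, h'⟩ := hFmem q hq
      exact hU.2 p q (Part.dom_iff_mem.2 ⟨v, (hsound _ _ _ _ h).2.2⟩)
        (Part.dom_iff_mem.2 ⟨u, (hsound _ _ _ _ h').2.2⟩) hpq
  have hsum : ∑ p ∈ F, 2 ^ (i - p.length) =
      ∑ n ∈ (Finset.range i).filter (fun n => (V i n).isSome),
        2 ^ (i - (((V i n).map Prod.fst).getD []).length) := by
    refine Finset.sum_image ?_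
    intro n hn m hm h
    simp only [Finset.coe_filter, Set.mem_ofPred_eq] at hn hm
    obtain ⟨⟨p, v⟩, hx⟩ := Option.isSome_iff_exists.1 hn.2
    obtain ⟨⟨q, u⟩, hy⟩ := Option.isSome_iff_exists.1 hm.2
    simp only [hx, hy, Option.map_some, Option.getD_some] at h
    rw [← (hsound _ _ _ _ hx).1, ← (hsound _ _ _ _ hy).1, h]
  calc numV V w i ≤ ∑ n ∈ (Finset.range i).filter (fun n => (V i n).isSome),
        2 ^ (i - (((V i n).map Prod.fst).getD []).length) * 2 ^ w.length := by
        rw [Finset.sum_filter]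
        refine Finset.sum_le_sum (fun n _ => ?_)
        unfold termV
        cases V i n with
        | none => simp
        | some x => simpa using hW_le x.2 w
    _ = (∑ p ∈ F, 2 ^ (i - p.length)) * 2 ^ w.length := by
        rw [hsum, Finset.sum_mul]
    _ ≤ _ := Nat.mul_le_mul_right _ hk

end

theorem gale_of_machine (U : List Bool →. List Bool) (hU : PFMachine U) (a b : ℕ) (ha : 0 < a)
    (hb : 0 < b) : ∃ d : List Bool → ℝ, LowerSemicomputable d ∧ (∀ w, 0 ≤ d w) ∧
      (∀ w, ((a : ℝ) / b) * d w = d (w ++ [false]) + d (w ++ [true])) ∧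
      ∀ p w, w ∈ U p → ((a : ℝ) / b) ^ w.length / 2 ^ p.length ≤ d w := by
  obtain ⟨V, hV, hmono, hsound, hcomp⟩ := exists_stages U hU.1
  let g : List Bool → ℕ → ℚ := fun w i =>
    ((a ^ w.length * numV V w i : ℕ) : ℚ) / ((b ^ w.length * (2 ^ i * 2 ^ w.length) : ℕ) : ℚ)
  have hgval : ∀ w i, ((g w i : ℚ) : ℝ) =
      ((a : ℝ) / b) ^ w.length * ((numV V w i : ℝ) / (2 ^ i * 2 ^ w.length)) := by
    intro w i
    simp only [g]
    push_cast
    rw [div_pow, div_mul_div_comm]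
  have hr : 0 < (a : ℝ) / b := by positivity
  have hgc : Computable₂ g := by
    have hlen : Primrec (fun x : List Bool × ℕ => x.1.length) :=
      Primrec.list_length.comp Primrec.fst
    refine computable_ratdiv (f := fun x : List Bool × ℕ => a ^ x.1.length * numV V x.1 x.2)
      (g := fun x : List Bool × ℕ => b ^ x.1.length * (2 ^ x.2 * 2 ^ x.1.length)) ?_ ?_ ?_
    · exact (Primrec.nat_mul.comp (primrec_pow.comp (Primrec.const a) hlen)
        ((primrec_numV hV).comp Primrec.fst Primrec.snd)).to_comp
    · exact (Primrec.nat_mul.comp (primrec_pow.comp (Primrec.const b) hlen)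
        (Primrec.nat_mul.comp (primrec_pow.comp (Primrec.const 2) Primrec.snd)
          (primrec_pow.comp (Primrec.const 2) hlen))).to_comp
    · intro x; positivity
  have hgm : ∀ w, Monotone fun i => (g w i : ℝ) := by
    intro w
    refine monotone_nat_of_le_succ (fun i => ?_)
    rw [hgval, hgval]
    refine mul_le_mul_of_nonneg_left ?_ (by positivity)
    rw [div_le_div_iff₀ (by positivity) (by positivity), pow_succ]
    have h : (2 * numV V w i : ℝ) ≤ numV V w (i + 1) := by
      exact_mod_cast numV_mono hmono hsound w i
    have h2 : (0 : ℝ) < 2 ^ i * 2 ^ w.length := by positivity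
    nlinarith
  have hgb : ∀ w i, (g w i : ℝ) ≤ ((a : ℝ) / b) ^ w.length := by
    intro w i
    rw [hgval]
    have h : (numV V w i : ℝ) ≤ 2 ^ i * 2 ^ w.length := by
      exact_mod_cast numV_le hU hsound w i
    have : (numV V w i : ℝ) / (2 ^ i * 2 ^ w.length) ≤ 1 := div_le_one_of_le₀ h (by positivity)
    exact mul_le_of_le_one_right (by positivity) this
  have hbdd : ∀ w, BddAbove (Set.range fun i => (g w i : ℝ)) := by
    intro w
    refine ⟨((a : ℝ) / b) ^ w.length, ?_⟩
    rintro _ ⟨i, rfl⟩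
    exact hgb w i
  have ht : ∀ w, Tendsto (fun i => (g w i : ℝ)) atTop (𝓝 (⨆ i, (g w i : ℝ))) :=
    fun w => tendsto_atTop_ciSup (hgm w) (hbdd w)
  have hg0 : ∀ w i, 0 ≤ (g w i : ℝ) := by
    intro w i
    rw [hgval]
    positivity
  refine ⟨fun w => ⨆ i, (g w i : ℝ), ⟨g, hgc, hgm, ht⟩, ?_, ?_, ?_⟩
  · exact fun w => (hg0 w 0).trans (le_ciSup (hbdd w) 0)
  · intro w
    refine tendsto_nhds_unique ((ht w).const_mul _) ?_
    refine ((ht (w ++ [false])).add (ht (w ++ [true]))).congr (fun i => ?_)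
    rw [hgval, hgval, hgval]
    have h : (2 * numV V w i : ℝ) = numV V (w ++ [false]) i + numV V (w ++ [true]) i := by
      exact_mod_cast numV_gale V w i
    simp only [List.length_append, List.length_singleton, pow_succ]
    rw [← mul_add, ← add_div, ← h]
    field_simp
  · intro p w hw
    obtain ⟨i, hi⟩ := hcomp p w hw
    refine le_trans ?_ (le_ciSup (hbdd w) i)
    rw [hgval, div_eq_mul_one_div]
    refine mul_le_mul_of_nonneg_left ?_ (by positivity)
    obtain ⟨_, h3, _⟩ := hsound i _ p w hi
    have h5 : p.length ≤ i := (Encodable.length_le_encode p).trans (by omega)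
    have h6 : 2 ^ (i - p.length) * 2 ^ w.length ≤ numV V w i := by
      have h7 : termV V w i (Encodable.encode p) = 2 ^ (i - p.length) * 2 ^ w.length := by
        unfold termV
        rw [Option.mem_def.1 hi]
        simp [hW_self]
      rw [← h7]
      exact Finset.single_le_sum (f := fun n => termV V w i n) (fun _ _ => Nat.zero_le _)
        (Finset.mem_range.2 h3)
    have h8 : (2 : ℝ) ^ (i - p.length) * 2 ^ w.length ≤ numV V w i := by exact_mod_cast h6
    rw [div_le_div_iff₀ (by positivity) (by positivity), one_mul]
    have h9 : (2 : ℝ) ^ i = 2 ^ (i - p.length) * 2 ^ p.length := by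
      rw [← pow_add, Nat.sub_add_cancel h5]
    have h10 : (0 : ℝ) < 2 ^ p.length := by positivity
    rw [h9]
    nlinarith

/-! ### The machine built from a gale -/

/-- One enumeration step. -/
def enumStep (g : List Bool → ℕ → ℚ) (k j t : ℕ) (l : List (List Bool)) : List (List Bool) :=
  Option.casesOn (Encodable.decode (α := List Bool × ℕ) t) l fun x =>
    bif decide (x.1.length / k = j ∧ ¬ l.idxOf x.1 < l.length) && decide (1 < g x.1 x.2)
    then l ++ [x.1] else l

/-- Enumeration of the strings `w` with `|w| / k = j` and `1 < g w i` for some `i`. -/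
def enumL (g : List Bool → ℕ → ℚ) (k j t : ℕ) : List (List Bool) :=
  Nat.rec (motive := fun _ => List (List Bool)) [] (fun t l => enumStep g k j t l) t

theorem computable_enumL {g : List Bool → ℕ → ℚ} (hg : Computable₂ g) (k : ℕ) :
    Computable₂ (enumL g k) := by
  have hstep : Computable₂ (fun (a : ℕ × ℕ) (p : ℕ × List (List Bool)) =>
      enumStep g k a.1 p.1 p.2) := by
    refine Computable.option_casesOn (Computable.decode.comp (Computable.fst.comp Computable.snd))
      (Computable.snd.comp Computable.snd) ?_
    have hp : Primrec (fun y : (((ℕ × ℕ) × ℕ × List (List Bool)) × List Bool × ℕ) =>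
        decide (y.2.1.length / k = y.1.1.1 ∧ ¬ y.1.2.2.idxOf y.2.1 < y.1.2.2.length)) := by
      have : PrimrecPred (fun y : (((ℕ × ℕ) × ℕ × List (List Bool)) × List Bool × ℕ) =>
          (y.2.1.length / k = y.1.1.1 ∧ ¬ y.1.2.2.idxOf y.2.1 < y.1.2.2.length)) := by
        have hl := Primrec.snd.comp (Primrec.snd.comp (Primrec.fst
          (α := (ℕ × ℕ) × ℕ × List (List Bool)) (β := List Bool × ℕ)))
        have hw := Primrec.fst.comp (Primrec.snd
          (α := (ℕ × ℕ) × ℕ × List (List Bool)) (β := List Bool × ℕ))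
        refine PrimrecPred.and ?_ (PrimrecPred.not ?_)
        · exact Primrec.eq.comp (Primrec.nat_div.comp (Primrec.list_length.comp hw)
            (Primrec.const k)) (Primrec.fst.comp (Primrec.fst.comp Primrec.fst))
        · have hi : Primrec (fun y : (((ℕ × ℕ) × ℕ × List (List Bool)) × List Bool × ℕ) =>
              y.1.2.2.idxOf y.2.1) := by
            refine (Primrec.list_idxOf.comp hw hl).of_eq (fun y => ?_)
            congr 1
            exact lawful_beq_subsingleton _ _
          exact Primrec.nat_lt.comp hi (Primrec.list_length.comp hl)
      exact this.decide
    have hq : Computable (fun y : (((ℕ × ℕ) × ℕ × List (List Bool)) × List Bool × ℕ) =>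
        decide (1 < g y.2.1 y.2.2)) :=
      computable_one_lt.comp (hg.comp (Computable.fst.comp Computable.snd)
        (Computable.snd.comp Computable.snd))
    refine Computable.cond (Primrec.and.to_comp.comp hp.to_comp hq) ?_ ?_
    · exact Computable.list_concat.comp (Computable.snd.comp (Computable.snd.comp Computable.fst))
        (Computable.fst.comp Computable.snd)
    · exact Computable.snd.comp (Computable.snd.comp Computable.fst)
  exact Computable.nat_rec (f := fun a : ℕ × ℕ => a.2) Computable.snd
    (Computable.const ([] : List (List Bool))) hstep

theorem enumL_succ (g : List Bool → ℕ → ℚ) (k j t : ℕ) :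
    enumL g k j (t + 1) = enumStep g k j t (enumL g k j t) := rfl

theorem enumStep_cases (g : List Bool → ℕ → ℚ) (k j t : ℕ) (l : List (List Bool)) :
    enumStep g k j t l = l ∨ ∃ w i, w.length / k = j ∧ w ∉ l ∧ 1 < g w i ∧
      enumStep g k j t l = l ++ [w] := by
  unfold enumStep
  cases Encodable.decode (α := List Bool × ℕ) t with
  | none => exact Or.inl rfl
  | some x =>
    by_cases h : (x.1.length / k = j ∧ ¬ l.idxOf x.1 < l.length) ∧ 1 < g x.1 x.2
    · right
      refine ⟨x.1, x.2, h.1.1, ?_, h.2, ?_⟩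
      · intro hx
        exact h.1.2 (List.idxOf_lt_length_of_mem hx)
      · simp only [decide_eq_true h.1, decide_eq_true h.2, Bool.and_self, cond_true]
    · left
      have : (decide (x.1.length / k = j ∧ ¬ l.idxOf x.1 < l.length) && decide (1 < g x.1 x.2))
          = false := by
        rw [Bool.eq_false_iff]
        intro hh
        simp only [Bool.and_eq_true, decide_eq_true_eq] at hh
        exact h hh
      simp only [this, cond_false]

theorem enumL_prefix (g : List Bool → ℕ → ℚ) (k j : ℕ) {t t' : ℕ} (h : t ≤ t') :
    enumL g k j t <+: enumL g k j t' := by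
  induction h with
  | refl => exact List.prefix_rfl
  | step _ ih =>
    refine ih.trans ?_
    rw [Nat.succ_eq_add_one, enumL_succ]
    rcases enumStep_cases g k j _ (enumL g k j _) with h | ⟨w, i, _, _, _, h⟩
    · rw [h]
    · rw [h]; exact List.prefix_append _ _

theorem enumL_nodup (g : List Bool → ℕ → ℚ) (k j t : ℕ) : (enumL g k j t).Nodup := by
  induction t with
  | zero => exact List.nodup_nil
  | succ t ih =>
    rw [enumL_succ]
    rcases enumStep_cases g k j t (enumL g k j t) with h | ⟨w, i, _, hw, _, h⟩
    · rw [h]; exact ih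
    · rw [h, List.nodup_append]
      refine ⟨ih, List.nodup_singleton _, ?_⟩
      intro a ha b hb hab
      simp only [List.mem_singleton] at hb
      exact hw (by rw [← hb, ← hab]; exact ha)

theorem enumL_mem (g : List Bool → ℕ → ℚ) (k j t : ℕ) (w : List Bool) (hw : w ∈ enumL g k j t) :
    w.length / k = j ∧ ∃ i, 1 < g w i := by
  induction t with
  | zero => exact absurd hw List.not_mem_nil
  | succ t ih =>
    rw [enumL_succ] at hw
    rcases enumStep_cases g k j t (enumL g k j t) with h | ⟨v, i, hv, _, hi, h⟩
    · rw [h] at hw; exact ih hw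
    · rw [h, List.mem_append, List.mem_singleton] at hw
      rcases hw with hw | rfl
      · exact ih hw
      · exact ⟨hv, i, hi⟩

theorem mem_enumL (g : List Bool → ℕ → ℚ) (k : ℕ) (w : List Bool) (i : ℕ) (hi : 1 < g w i) :
    ∃ t, w ∈ enumL g k (w.length / k) t := by
  refine ⟨Encodable.encode (w, i) + 1, ?_⟩
  rw [enumL_succ]
  set l := enumL g k (w.length / k) (Encodable.encode (w, i)) with hl
  unfold enumStep
  rw [Encodable.encodek]
  by_cases hw : w ∈ l
  · have : l.idxOf w < l.length := List.idxOf_lt_length_of_mem hw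
    simp [this, hw]
  · have : ¬ l.idxOf w < l.length := fun h => hw (List.idxOf_lt_length_iff.1 h)
    have h2 : l.length ≤ l.idxOf w := by omega
    simp [h2, hi]

/-- Binary value of a string. -/
def valB (b : List Bool) : ℕ := b.foldl (fun s x => 2 * s + cond x 1 0) 0

theorem primrec_valB : Primrec valB := by
  refine Primrec.list_foldl (h := fun _ (p : ℕ × Bool) => 2 * p.1 + cond p.2 1 0)
    Primrec.id (Primrec.const 0) ?_
  refine Primrec.nat_add.comp (Primrec.nat_mul.comp (Primrec.const 2)
    (Primrec.fst.comp Primrec.snd)) ?_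
  exact Primrec.cond (Primrec.snd.comp Primrec.snd) (Primrec.const 1) (Primrec.const 0)

theorem exists_valB (L m : ℕ) (h : m < 2 ^ L) : ∃ b : List Bool, b.length = L ∧ valB b = m := by
  induction L generalizing m with
  | zero => exact ⟨[], rfl, by simp at h; simp [valB, h]⟩
  | succ L ih =>
    obtain ⟨b, hb, hv⟩ := ih (m / 2) (by rw [pow_succ] at h; omega)
    unfold valB at hv
    rcases Nat.mod_two_eq_zero_or_one m with h0 | h0
    · refine ⟨b ++ [false], by simp [hb], ?_⟩
      simp only [valB, List.foldl_append, hv, List.foldl_cons, List.foldl_nil, cond_false]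
      omega
    · refine ⟨b ++ [true], by simp [hb], ?_⟩
      simp only [valB, List.foldl_append, hv, List.foldl_cons, List.foldl_nil, cond_true]
      omega

/-- Staged output of the machine. -/
def machF (g : List Bool → ℕ → ℚ) (k a c : ℕ) (p : List Bool) (t : ℕ) : Option (List Bool) :=
  bif decide (p.length = p.idxOf false + 1 + (a * (p.idxOf false + 1) + c)) then
    (enumL g k (p.idxOf false) t)[valB (p.drop (p.idxOf false + 1))]? else none

/-- The machine: on input `1^j 0 b` it outputs the string of index `b` in the `j`-th enumeration. -/
def mach (g : List Bool → ℕ → ℚ) (k a c : ℕ) : List Bool →. List Bool :=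
  fun p => Nat.rfindOpt (machF g k a c p)

theorem mach_partrec {g : List Bool → ℕ → ℚ} (hg : Computable₂ g) (k a c : ℕ) :
    Partrec (mach g k a c) := by
  refine Partrec.rfindOpt ?_
  have hj : Primrec (fun x : List Bool × ℕ => x.1.idxOf false) :=
    Primrec.list_idxOf.comp (Primrec.const false) Primrec.fst
  have hc : Primrec (fun x : List Bool × ℕ =>
      decide (x.1.length = x.1.idxOf false + 1 + (a * (x.1.idxOf false + 1) + c))) := by
    have : PrimrecPred (fun x : List Bool × ℕ =>
      (x.1.length = x.1.idxOf false + 1 + (a * (x.1.idxOf false + 1) + c))) := by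
      refine Primrec.eq.comp (Primrec.list_length.comp Primrec.fst) ?_
      refine Primrec.nat_add.comp (Primrec.succ.comp hj) ?_
      exact Primrec.nat_add.comp (Primrec.nat_mul.comp (Primrec.const a) (Primrec.succ.comp hj))
        (Primrec.const c)
    exact this.decide
  refine Computable.cond hc.to_comp ?_ (Computable.const none)
  refine Computable.list_getElem?.comp ?_ ?_
  · exact (computable_enumL hg k).comp hj.to_comp Computable.snd
  · exact (primrec_valB.comp (Primrec.list_drop.comp (Primrec.succ.comp hj) Primrec.fst)).to_comp

theorem mach_dom {g : List Bool → ℕ → ℚ} {k a c : ℕ} {p : List Bool} (h : (mach g k a c p).Dom) :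
    p.length = p.idxOf false + 1 + (a * (p.idxOf false + 1) + c) := by
  obtain ⟨t, w, hw⟩ := Nat.rfindOpt_dom.1 h
  by_contra hne
  unfold machF at hw
  rw [decide_eq_false hne] at hw
  simp at hw

theorem mach_pf {g : List Bool → ℕ → ℚ} (hg : Computable₂ g) (k a c : ℕ) :
    PFMachine (mach g k a c) := by
  refine ⟨mach_partrec hg k a c, ?_⟩
  intro p q hp hq hpq
  have h1 := mach_dom hp
  have h2 := mach_dom hq
  have h3 : q.idxOf false = p.idxOf false := by
    obtain ⟨r, rfl⟩ := hpq
    rw [List.idxOf_append_of_mem]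
    rw [← List.idxOf_lt_length_iff]
    omega
  refine hpq.eq_of_length ?_
  rw [h1, h2, h3]

theorem mach_mem {g : List Bool → ℕ → ℚ} {k a c : ℕ}
    (hcard : ∀ j t, (enumL g k j t).length ≤ 2 ^ (a * (j + 1) + c)) (w : List Bool) (i : ℕ)
    (hi : 1 < g w i) : ∃ p, w ∈ mach g k a c p ∧
      p.length = w.length / k + 1 + (a * (w.length / k + 1) + c) := by
  obtain ⟨t, ht⟩ := mem_enumL g k w i hi
  set j := w.length / k with hj
  obtain ⟨m, hm, hmw⟩ := List.mem_iff_getElem.1 ht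
  obtain ⟨b, hb, hv⟩ := exists_valB (a * (j + 1) + c) m (hm.trans_le (hcard j t))
  let p := List.replicate j true ++ false :: b
  have hidx : p.idxOf false = j := by
    simp only [p]
    rw [List.idxOf_append_of_notMem (by simp)]
    simp
  have hlen : p.length = j + 1 + (a * (j + 1) + c) := by
    simp only [p, List.length_append, List.length_replicate, List.length_cons, hb]
    omega
  have hdrop : p.drop (j + 1) = b := by
    simp only [p]
    rw [List.drop_append]
    simp
  refine ⟨p, ?_, hlen⟩
  have hF : ∀ t, machF g k a c p t = (enumL g k j t)[m]? := by
    intro t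
    unfold machF
    rw [hidx, hdrop, hv, decide_eq_true hlen, cond_true]
  refine (Nat.rfindOpt_mono ?_).2 ⟨t, ?_⟩
  · intro x s s' hss hx
    rw [hF] at hx ⊢
    obtain ⟨u, hu⟩ := enumL_prefix g k j hss
    rw [← hu]
    obtain ⟨hlt, hx⟩ := List.getElem?_eq_some_iff.1 hx
    rw [Option.mem_def, List.getElem?_append_left hlt, List.getElem?_eq_some_iff]
    exact ⟨hlt, hx⟩
  · rw [hF]
    exact List.getElem?_eq_some_iff.2 ⟨hm, hmw⟩

/-! ### Counting and the main theorem -/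

theorem gale_sum {s : ℝ} {d : List Bool → ℝ} (hd : IsSGale s d) (n : ℕ) :
    ∑ w ∈ strs n, d w = ((2 : ℝ) ^ s) ^ n * d [] := by
  induction n with
  | zero => simp [strs]
  | succ n ih =>
    rw [sum_strs_succ, Finset.sum_congr rfl (fun w _ => (hd.2 w).symm), ← Finset.mul_sum, ih,
      pow_succ]
    ring

theorem enumL_card {s : ℝ} {d : List Bool → ℝ} (hs : 0 ≤ s) (hd : IsSGale s d)
    {g : List Bool → ℕ → ℚ} (hg : ∀ w i, (g w i : ℝ) ≤ d w) {k a c : ℕ} (hk : 0 < k)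
    (ha : s * k ≤ a) (hc : k * d [] ≤ 2 ^ c) (j t : ℕ) :
    (enumL g k j t).length ≤ 2 ^ (a * (j + 1) + c) := by
  classical
  have hd0 := hd.1
  have hsub : (enumL g k j t).toFinset ⊆ (Finset.range k).biUnion (fun m => strs (k * j + m)) := by
    intro w hw
    rw [List.mem_toFinset] at hw
    obtain ⟨h1, _⟩ := enumL_mem g k j t w hw
    simp only [Finset.mem_biUnion, Finset.mem_range, mem_strs]
    refine ⟨w.length % k, Nat.mod_lt _ hk, ?_⟩
    rw [← h1]
    exact (Nat.div_add_mod _ _).symm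
  have hterm : ∀ m ∈ Finset.range k, ∑ w ∈ strs (k * j + m), d w ≤ 2 ^ (a * (j + 1)) * d [] := by
    intro m hm
    rw [gale_sum hd]
    refine mul_le_mul_of_nonneg_right ?_ (hd0 [])
    have h2 : (k * j + m : ℕ) ≤ k * (j + 1) := by
      rw [mul_add, mul_one]
      exact Nat.add_le_add_left (Finset.mem_range.1 hm).le _
    have h3 : (1 : ℝ) ≤ 2 ^ s := Real.one_le_rpow (by norm_num) hs
    calc ((2 : ℝ) ^ s) ^ (k * j + m) ≤ ((2 : ℝ) ^ s) ^ (k * (j + 1)) := pow_le_pow_right₀ h3 h2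
      _ = ((2 : ℝ) ^ (s * k)) ^ (j + 1) := by
        rw [pow_mul, Real.rpow_mul (by norm_num), Real.rpow_natCast]
      _ ≤ ((2 : ℝ) ^ (a : ℝ)) ^ (j + 1) := by
        refine pow_le_pow_left₀ (by positivity) ?_ _
        exact Real.rpow_le_rpow_of_exponent_le (by norm_num) ha
      _ = 2 ^ (a * (j + 1)) := by rw [Real.rpow_natCast, pow_mul]
  have hR : ((enumL g k j t).length : ℝ) ≤ 2 ^ (a * (j + 1) + c) := by
    calc ((enumL g k j t).length : ℝ) = ∑ w ∈ (enumL g k j t).toFinset, (1 : ℝ) := by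
          rw [Finset.sum_const, List.toFinset_card_of_nodup (enumL_nodup g k j t)]
          simp
      _ ≤ ∑ w ∈ (enumL g k j t).toFinset, d w := by
          refine Finset.sum_le_sum (fun w hw => ?_)
          rw [List.mem_toFinset] at hw
          obtain ⟨_, i, hi⟩ := enumL_mem g k j t w hw
          have : (1 : ℝ) < g w i := by exact_mod_cast hi
          exact this.le.trans (hg w i)
      _ ≤ ∑ w ∈ (Finset.range k).biUnion (fun m => strs (k * j + m)), d w :=
          Finset.sum_le_sum_of_subset_of_nonneg hsub (fun w _ _ => hd0 w)
      _ = ∑ m ∈ Finset.range k, ∑ w ∈ strs (k * j + m), d w := by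
          refine Finset.sum_biUnion ?_
          intro m _ m' _ hne
          refine Finset.disjoint_left.2 (fun w hw hw' => hne ?_)
          rw [mem_strs] at hw hw'
          omega
      _ ≤ ∑ m ∈ Finset.range k, 2 ^ (a * (j + 1)) * d [] := Finset.sum_le_sum hterm
      _ = 2 ^ (a * (j + 1)) * (k * d []) := by
          rw [Finset.sum_const, Finset.card_range, nsmul_eq_mul]
          ring
      _ ≤ 2 ^ (a * (j + 1)) * 2 ^ c := mul_le_mul_of_nonneg_left hc (by positivity)
      _ = 2 ^ (a * (j + 1) + c) := by rw [pow_add]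
  exact_mod_cast hR

theorem K_le {U : List Bool →. List Bool} {w p : List Bool} (h : w ∈ U p) : K U w ≤ p.length :=
  Nat.sInf_le ⟨p, h, rfl⟩

theorem pref_length (X : Cantor) (n : ℕ) : (pref X n).length = n := by simp [pref]

/-- A gale succeeding on `X` is larger than `1` on infinitely many prefixes. -/
theorem succeeds_frequently {d : List Bool → ℝ} {X : Cantor} (h : SucceedsOn d X) (N : ℕ) :
    ∃ n ≥ N, 1 < d (pref X n) := by
  by_contra hcon
  push Not at hcon
  obtain ⟨n, hn⟩ := h (1 + ∑ m ∈ Finset.range N, |d (pref X m)|)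
  have h0 : 0 ≤ ∑ m ∈ Finset.range N, |d (pref X m)| := Finset.sum_nonneg (fun _ _ => abs_nonneg _)
  by_cases hnN : N ≤ n
  · have := hcon n hnN
    linarith
  · have h1 : |d (pref X n)| ≤ ∑ m ∈ Finset.range N, |d (pref X m)| :=
      Finset.single_le_sum (f := fun m => |d (pref X m)|) (fun _ _ => abs_nonneg _)
        (Finset.mem_range.2 (by omega))
    have := le_abs_self (d (pref X n))
    linarith

theorem freq_of_gale {U : List Bool →. List Bool} (hU : UniversalPF U) {X : Cantor} {s : ℝ}
    (hs : 0 ≤ s) {d : List Bool → ℝ} (hlsc : LowerSemicomputable d) (hd : IsSGale s d)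
    (hX : SucceedsOn d X) {ε : ℝ} (hε : 0 < ε) :
    ∃ᶠ n : ℕ in atTop, (K U (pref X n) : ℝ) / n ≤ s + ε := by
  obtain ⟨g, hgc, hgm, hgt⟩ := hlsc
  have hgle : ∀ w i, (g w i : ℝ) ≤ d w := fun w i => (hgm w).ge_of_tendsto (hgt w) i
  obtain ⟨k, hk⟩ := exists_nat_gt (3 / ε)
  have hkpos : (0 : ℝ) < k := lt_trans (by positivity) hk
  have hk0 : 0 < k := by exact_mod_cast hkpos
  set a := ⌈s * k⌉₊ with ha
  have ha1 : s * k ≤ a := Nat.le_ceil _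
  have ha2 : (a : ℝ) < s * k + 1 := Nat.ceil_lt_add_one (by positivity)
  obtain ⟨c, hc⟩ := pow_unbounded_of_one_lt (k * d []) (by norm_num : (1 : ℝ) < 2)
  have hcard := enumL_card hs hd hgle hk0 ha1 hc.le
  obtain ⟨c', hc'⟩ := hU.2 (mach g k a c) (mach_pf hgc k a c)
  rw [Filter.frequently_atTop]
  intro N
  obtain ⟨n, hn, h1⟩ := succeeds_frequently hX (max N (max 1 (k * (1 + a + c + c'))))
  have hnN : N ≤ n := le_trans (le_max_left _ _) hn
  have hn1 : 1 ≤ n := le_trans (le_trans (le_max_left _ _) (le_max_right _ _)) hn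
  have hnC : k * (1 + a + c + c') ≤ n :=
    le_trans (le_trans (le_max_right _ _) (le_max_right _ _)) hn
  refine ⟨n, hnN, ?_⟩
  obtain ⟨i, hi⟩ := ((hgt (pref X n)).eventually_const_lt h1).exists
  have hi' : 1 < g (pref X n) i := by exact_mod_cast hi
  obtain ⟨p, hp, hpl⟩ := mach_mem hcard (pref X n) i hi'
  obtain ⟨q, hq, hql⟩ := hc' _ _ hp
  have hK := K_le hq
  rw [pref_length] at hpl
  have hj : ((n / k : ℕ) : ℝ) * k ≤ n := by exact_mod_cast Nat.div_mul_le_self n k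
  set j := n / k with hjdef
  have hK2 : (K U (pref X n) : ℝ) ≤ j + 1 + (a * (j + 1) + c) + c' := by
    have : K U (pref X n) ≤ j + 1 + (a * (j + 1) + c) + c' := by omega
    exact_mod_cast this
  have hnpos : (0 : ℝ) < n := by exact_mod_cast hn1
  rw [div_le_iff₀ hnpos]
  have hnC' : (k : ℝ) * (1 + a + c + c') ≤ n := by exact_mod_cast hnC
  have hεk : 3 < ε * k := by
    rw [div_lt_iff₀ hε] at hk
    linarith
  -- multiply by `k`
  have h5 : (K U (pref X n) : ℝ) * k ≤ ((s + ε) * n) * k := by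
    have h6 : (K U (pref X n) : ℝ) * k ≤ (j * k) * (1 + a) + k * (1 + a + c + c') := by
      nlinarith
    have h7 : (j * k : ℝ) * (1 + a) ≤ n * (1 + a) :=
      mul_le_mul_of_nonneg_right hj (by positivity)
    have h8 : (n : ℝ) * (1 + a) ≤ n * (s * k + 2) :=
      mul_le_mul_of_nonneg_left (by linarith) hnpos.le
    have h9 : (n : ℝ) * 3 ≤ n * (ε * k) := mul_le_mul_of_nonneg_left hεk.le hnpos.le
    nlinarith
  exact le_of_mul_le_mul_right h5 hkpos

/-- Every string has a program. -/
theorem exists_program {U : List Bool →. List Bool} (hU : UniversalPF U) (w : List Bool) :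
    ∃ p, w ∈ U p ∧ p.length = K U w := by
  have hM : PFMachine (fun p : List Bool =>
      ((bif decide (p = []) then some w else none : Option (List Bool)) : Part (List Bool))) := by
    constructor
    · refine Computable.ofOption ?_
      have : PrimrecPred (fun p : List Bool => p = []) :=
        Primrec.eq.comp Primrec.id (Primrec.const [])
      exact Computable.cond this.decide.to_comp (Computable.const _) (Computable.const _)
    · have key : ∀ p : List Bool, ((bif decide (p = []) then some w else none :
          Option (List Bool)) : Part (List Bool)).Dom → p = [] := by
        intro p hp
        by_contra h
        rw [decide_eq_false h] at hp
        simp at hp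
      intro p q hp hq _
      rw [key p hp, key q hq]
  obtain ⟨c, hc⟩ := hU.2 _ hM
  obtain ⟨q, hq, _⟩ := hc w [] (by simp)
  have hne : {n : ℕ | ∃ p : List Bool, w ∈ U p ∧ p.length = n}.Nonempty := ⟨_, q, hq, rfl⟩
  exact Nat.sInf_mem hne

/-- The trivial gale shows that the dimension is at most `2`. -/
theorem trivial_gale (X : Cantor) : ∃ d : List Bool → ℝ,
    LowerSemicomputable d ∧ IsSGale 2 d ∧ SucceedsOn d X := by
  refine ⟨fun w => 2 ^ w.length, ⟨fun w _ => ((2 ^ w.length : ℕ) : ℚ) / ((1 : ℕ) : ℚ), ?_, ?_, ?_⟩,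
    ⟨fun w => by positivity, fun w => ?_⟩, fun C => ?_⟩
  · refine computable_ratdiv (f := fun x : List Bool × ℕ => 2 ^ x.1.length) (g := fun _ => 1)
      ?_ (Computable.const 1) (fun _ => one_pos)
    exact (primrec_pow.comp (Primrec.const 2) (Primrec.list_length.comp Primrec.fst)).to_comp
  · intro w
    exact monotone_const
  · intro w
    simp
  · simp only [List.length_append, List.length_singleton, pow_succ]
    rw [Real.rpow_two]
    ring
  · obtain ⟨n, hn⟩ := pow_unbounded_of_one_lt C (by norm_num : (1 : ℝ) < 2)
    exact ⟨n, by simpa only [pref_length] using hn⟩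

theorem mem_of_freq {U : List Bool →. List Bool} (hU : UniversalPF U) {X : Cantor} {t1 t : ℝ}
    (h0 : 0 ≤ t1) (ht : t1 < t)
    (hf : ∃ᶠ n : ℕ in atTop, (K U (pref X n) : ℝ) / n < t1) :
    ∃ s, 0 ≤ s ∧ s < t ∧ ∃ d : List Bool → ℝ,
      LowerSemicomputable d ∧ IsSGale s d ∧ SucceedsOn d X := by
  obtain ⟨q, hq1, hq2⟩ := exists_rat_btwn
    (Real.rpow_lt_rpow_of_exponent_lt (by norm_num : (1 : ℝ) < 2) ht)
  have hqpos : (0 : ℝ) < q := lt_trans (by positivity) hq1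
  have hq0 : 0 < q := by exact_mod_cast hqpos
  set s := Real.logb 2 q with hs
  have h2s : (2 : ℝ) ^ s = q := Real.rpow_logb (by norm_num) (by norm_num) hqpos
  have hs1 : t1 < s := by
    rw [← h2s] at hq1
    exact (Real.rpow_lt_rpow_left_iff (by norm_num)).1 hq1
  have hs2 : s < t := by
    rw [← h2s] at hq2
    exact (Real.rpow_lt_rpow_left_iff (by norm_num)).1 hq2
  refine ⟨s, h0.trans hs1.le, hs2, ?_⟩
  have hnum : 0 < q.num := Rat.num_pos.2 hq0
  have hqab : ((q.num.toNat : ℝ) / q.den) = q := by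
    have h1 : ((q.num.toNat : ℕ) : ℤ) = q.num := Int.toNat_of_nonneg hnum.le
    have h2 : ((q.num.toNat : ℕ) : ℝ) = (q.num : ℝ) := by exact_mod_cast congrArg (Int.cast (R := ℝ)) h1
    rw [h2]
    exact (Rat.cast_def q).symm
  obtain ⟨d, hlsc, hnn, hgale, hbig⟩ := gale_of_machine U hU.1 q.num.toNat q.den (by omega) q.den_pos
  rw [hqab] at hgale hbig
  refine ⟨d, hlsc, ⟨hnn, fun w => by rw [h2s]; exact hgale w⟩, fun C => ?_⟩
  have hgrow : Tendsto (fun n : ℕ => ((2 : ℝ) ^ (s - t1)) ^ n) atTop atTop :=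
    tendsto_pow_atTop_atTop_of_one_lt (Real.one_lt_rpow (by norm_num) (by linarith))
  obtain ⟨n, hnK, hnC, hn1⟩ :=
    (hf.and_eventually ((hgrow.eventually_gt_atTop C).and (eventually_ge_atTop 1))).exists
  refine ⟨n, hnC.trans_le ?_⟩
  obtain ⟨p, hp, hpl⟩ := exists_program hU (pref X n)
  refine le_trans ?_ (hbig p _ hp)
  rw [pref_length, hpl, ← h2s]
  have hnpos : (0 : ℝ) < n := by exact_mod_cast hn1
  rw [div_lt_iff₀ hnpos] at hnK
  rw [← Real.rpow_natCast, ← Real.rpow_natCast, ← Real.rpow_natCast,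
    ← Real.rpow_mul (by norm_num), ← Real.rpow_mul (by norm_num), ← Real.rpow_sub (by norm_num)]
  refine Real.rpow_le_rpow_of_exponent_le (by norm_num) ?_
  linarith

/-- Mayordomo's theorem: the constructive dimension of any sequence `X` equals
`liminf_n K(X↾n)/n`, for prefix-free Kolmogorov complexity `K` with respect to
any universal prefix-free machine. -/
theorem cdim_eq_liminf_K (U : List Bool →. List Bool) (hU : UniversalPF U)
    (X : Cantor) : cdim {X} = dimK U X := by
  have hbdd : IsBoundedUnder (· ≥ ·) atTop (fun n : ℕ => (K U (pref X n) : ℝ) / n) :=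
    isBoundedUnder_of ⟨0, fun n => by positivity⟩
  have hcob : IsCoboundedUnder (· ≥ ·) atTop (fun n : ℕ => (K U (pref X n) : ℝ) / n) := by
    obtain ⟨d, h1, h2, h3⟩ := trivial_gale X
    exact IsCoboundedUnder.of_frequently_le (freq_of_gale hU (by norm_num) h1 h2 h3 one_pos)
  have hBdd : BddBelow {s : ℝ | 0 ≤ s ∧ ∃ d : List Bool → ℝ,
      LowerSemicomputable d ∧ IsSGale s d ∧ ∀ Y ∈ ({X} : Set Cantor), SucceedsOn d Y} :=
    ⟨0, fun s hs => hs.1⟩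
  have h0 : 0 ≤ dimK U X := by
    refine le_liminf_of_le hcob (Eventually.of_forall fun n => ?_)
    positivity
  apply le_antisymm
  · refine le_of_forall_pos_le_add (fun ε hε => ?_)
    have hlt : dimK U X < dimK U X + ε / 2 := by linarith
    have hf := frequently_lt_of_liminf_lt hcob hlt
    obtain ⟨s, hs0, hs, d, h1, h2, h3⟩ := mem_of_freq hU (t1 := dimK U X + ε / 2)
      (t := dimK U X + ε) (by linarith) (by linarith) hf
    refine le_trans (csInf_le hBdd ⟨hs0, d, h1, h2, ?_⟩) hs.le
    intro Y hY
    rw [Set.mem_singleton_iff.1 hY]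
    exact h3
  · refine le_csInf ?_ ?_
    · obtain ⟨d, h1, h2, h3⟩ := trivial_gale X
      refine ⟨2, by norm_num, d, h1, h2, ?_⟩
      intro Y hY
      rw [Set.mem_singleton_iff.1 hY]
      exact h3
    · rintro s ⟨hs, d, h1, h2, h3⟩
      refine le_of_forall_pos_le_add (fun ε hε => ?_)
      exact liminf_le_of_frequently_le (freq_of_gale hU hs h1 h2 (h3 X rfl) hε) hbdd
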